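/- L^p Fefferman–Stein type inequality for the strong maximal operator: for every p > 1 there is C_p > 0 such that for every weight w on ℝ² and W = M_R M_Q w, ‖M_R f‖_{L^p(ℝ², w)} ≤ C_p ‖f‖_{L^p(ℝ², W)} for all f ∈ L^p(ℝ², W). -/

import Mathlib

open MeasureTheory Set
open scoped ENNReal

noncomputable section

/-- A cube (square) in the plane with sides parallel to the axes. -/
def IsCube2 (Q : Set (ℝ × ℝ)) : Prop :=
  ∃ a b r : ℝ, 0 < r ∧ Q = Ioo a (a + r) ×ˢ Ioo b (b + r)

/-- A rectangle in the plane with sides parallel to the axes. -/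
def IsRect2 (R : Set (ℝ × ℝ)) : Prop :=
  ∃ a₁ b₁ a₂ b₂ : ℝ, a₁ < b₁ ∧ a₂ < b₂ ∧ R = Ioo a₁ b₁ ×ˢ Ioo a₂ b₂

/-- The Hardy–Littlewood maximal operator over cubes in the plane. -/
def MHL2 (f : ℝ × ℝ → ℝ) (x : ℝ × ℝ) : ℝ≥0∞ :=
  ⨆ (Q : Set (ℝ × ℝ)) (_ : IsCube2 Q ∧ x ∈ Q),
    (∫⁻ y in Q, ENNReal.ofReal |f y|) / volume Q

/-- The strong maximal operator over axes-parallel rectangles in the plane. -/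
def MR2 (f : ℝ × ℝ → ℝ) (x : ℝ × ℝ) : ℝ≥0∞ :=
  ⨆ (R : Set (ℝ × ℝ)) (_ : IsRect2 R ∧ x ∈ R),
    (∫⁻ y in R, ENNReal.ofReal |f y|) / volume R

/-- The strong maximal operator acting on `ℝ≥0∞`-valued functions. -/
def MR2e (g : ℝ × ℝ → ℝ≥0∞) (x : ℝ × ℝ) : ℝ≥0∞ :=
  ⨆ (R : Set (ℝ × ℝ)) (_ : IsRect2 R ∧ x ∈ R),
    (∫⁻ y in R, g y) / volume R

lemma add_pow_succ_le (b S : ℝ≥0∞) (m : ℕ) :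
    (b + S) ^ (m + 1) ≤ S ^ (m + 1) + (m + 1) * (b * (b + S) ^ m) := by
  induction m with
  | zero => simp [add_comm]
  | succ m ih =>
    have h : S ^ (m + 1) ≤ (b + S) ^ (m + 1) := pow_le_pow_left' le_add_self _
    calc (b + S) ^ (m + 1 + 1) = (b + S) ^ (m + 1) * (b + S) := pow_succ _ _
      _ ≤ (S ^ (m + 1) + (m + 1) * (b * (b + S) ^ m)) * (b + S) := by gcongr
      _ = S ^ (m + 1 + 1) + b * S ^ (m + 1) + (m + 1) * (b * (b + S) ^ (m + 1)) := by ring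
      _ ≤ S ^ (m + 1 + 1) + b * (b + S) ^ (m + 1) + (m + 1) * (b * (b + S) ^ (m + 1)) := by
        gcongr
      _ = S ^ (m + 1 + 1) + ((m + 1 : ℕ) + 1) * (b * (b + S) ^ (m + 1)) := by
        push_cast; ring

/-- A power of a sum is controlled by grouping each product at its index of largest length. -/
lemma sum_pow_succ_le {ι : Type*} (s : Finset ι) (l : ι → ℝ) (b : ι → ℝ≥0∞) (m : ℕ) :
    (∑ i ∈ s, b i) ^ (m + 1) ≤
      (m + 1) * ∑ i ∈ s, b i * (∑ j ∈ s with l j ≤ l i, b j) ^ m := by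
  classical
  induction s using Finset.induction_on_max_value l with
  | empty => simp
  | insert a s ha hmax ih =>
    rw [Finset.sum_insert ha, Finset.sum_insert ha]
    have hfilter : Finset.filter (fun j => l j ≤ l a) (insert a s) = insert a s := by
      apply Finset.filter_true_of_mem
      intro j hj
      rcases Finset.mem_insert.1 hj with rfl | hj
      exacts [le_rfl, hmax j hj]
    rw [hfilter, Finset.sum_insert ha]
    calc (b a + ∑ i ∈ s, b i) ^ (m + 1)
        ≤ (∑ i ∈ s, b i) ^ (m + 1) + (m + 1) * (b a * (b a + ∑ i ∈ s, b i) ^ m) :=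
          add_pow_succ_le _ _ _
      _ ≤ (m + 1) * ∑ i ∈ s, b i * (∑ j ∈ s with l j ≤ l i, b j) ^ m
          + (m + 1) * (b a * (b a + ∑ i ∈ s, b i) ^ m) := by gcongr
      _ ≤ (m + 1) * ∑ i ∈ s, b i * (∑ j ∈ insert a s with l j ≤ l i, b j) ^ m
          + (m + 1) * (b a * (b a + ∑ i ∈ s, b i) ^ m) := by
        gcongr
        exact Finset.subset_insert _ _
      _ = _ := by rw [add_comm, mul_add]

open Classical in
/-- A finite sparse family of intervals satisfies the Carleson packing condition. -/
lemma sum_volume_le_of_sparse {ι : Type*} (t : Finset ι) (c d : ι → ℝ) (E : ι → Set ℝ)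
    (hE : ∀ i ∈ t, MeasurableSet (E i)) (hEJ : ∀ i ∈ t, E i ⊆ Ioo (c i) (d i))
    (hJE : ∀ i ∈ t, volume (Ioo (c i) (d i)) ≤ 2 * volume (E i))
    (hdisj : (t : Set ι).PairwiseDisjoint E) (i : ι) :
    ∑ j ∈ t with d j - c j ≤ d i - c i ∧ (Ioo (c i) (d i) ∩ Ioo (c j) (d j)).Nonempty,
      volume (Ioo (c j) (d j)) ≤ 6 * volume (Ioo (c i) (d i)) := by
  set u := t.filter fun j => d j - c j ≤ d i - c i ∧
    (Ioo (c i) (d i) ∩ Ioo (c j) (d j)).Nonempty with hu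
  have hut : u ⊆ t := Finset.filter_subset _ _
  calc ∑ j ∈ u, volume (Ioo (c j) (d j)) ≤ ∑ j ∈ u, 2 * volume (E j) :=
        Finset.sum_le_sum fun j hj => hJE j (hut hj)
    _ = 2 * volume (⋃ j ∈ u, E j) := by
        rw [← Finset.mul_sum, measure_biUnion_finset (hdisj.subset (by exact_mod_cast hut))
          fun j hj => hE j (hut hj)]
    _ ≤ 2 * volume (Ioo (c i - (d i - c i)) (d i + (d i - c i))) := by
        gcongr
        refine iUnion₂_subset fun j hj y hy => ?_
        have hy' := hEJ j (hut hj) hy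
        obtain ⟨-, hlen, z, hz1, hz2⟩ := Finset.mem_filter.1 hj
        simp only [mem_Ioo] at *
        constructor <;> linarith
    _ = 6 * volume (Ioo (c i) (d i)) := by
        rw [Real.volume_Ioo, Real.volume_Ioo,
          show d i + (d i - c i) - (c i - (d i - c i)) = 3 * (d i - c i) by ring,
          ENNReal.ofReal_mul (by norm_num), ← mul_assoc]
        norm_num

lemma measurable_sum_indicator {α ι : Type*} [MeasurableSpace α] (t : Finset ι) (J : ι → Set α)
    (hJ : ∀ i, MeasurableSet (J i)) :
    Measurable fun y => ∑ j ∈ t, (J j).indicator (1 : α → ℝ≥0∞) y :=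
  Finset.measurable_fun_sum _ fun j _ => measurable_one.indicator (hJ j)

/-- Moments of the overlap function of a sparse family of intervals. -/
lemma lintegral_overlap_pow_le {ι : Type*} (t : Finset ι) (c d : ι → ℝ) (E : ι → Set ℝ)
    (hE : ∀ i ∈ t, MeasurableSet (E i)) (hEJ : ∀ i ∈ t, E i ⊆ Ioo (c i) (d i))
    (hJE : ∀ i ∈ t, volume (Ioo (c i) (d i)) ≤ 2 * volume (E i))
    (hdisj : (t : Set ι).PairwiseDisjoint E) (m : ℕ) (i : ι) :
    ∫⁻ y in Ioo (c i) (d i), (∑ j ∈ t with d j - c j ≤ d i - c i,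
        (Ioo (c j) (d j)).indicator (1 : ℝ → ℝ≥0∞) y) ^ m
      ≤ (m.factorial * 6 ^ m : ℕ) * volume (Ioo (c i) (d i)) := by
  classical
  induction m generalizing i with
  | zero => simp
  | succ m ih =>
    set J : ι → Set ℝ := fun i => Ioo (c i) (d i) with hJ
    have hJm : ∀ i, MeasurableSet (J i) := fun i => measurableSet_Ioo
    let N : ι → ℝ → ℝ≥0∞ := fun i y =>
      ∑ j ∈ t with d j - c j ≤ d i - c i, (J j).indicator (1 : ℝ → ℝ≥0∞) y
    have hN : ∀ i, Measurable (N i) := fun i => measurable_sum_indicator _ _ hJm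
    let s := t.filter fun j => d j - c j ≤ d i - c i
    have key : ∀ y, N i y ^ (m + 1) ≤
        (m + 1) * ∑ j ∈ s, (J j).indicator (1 : ℝ → ℝ≥0∞) y * N j y ^ m := by
      intro y
      refine (sum_pow_succ_le s (fun j => d j - c j) _ m).trans ?_
      gcongr
      exact Finset.sum_le_sum_of_subset (Finset.filter_subset_filter _ (Finset.filter_subset _ _))
    have hterm : ∀ j ∈ s, ∫⁻ y in J i, (J j).indicator (1 : ℝ → ℝ≥0∞) y * N j y ^ m ≤
        if (J i ∩ J j).Nonempty then (m.factorial * 6 ^ m : ℕ) * volume (J j) else 0 := by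
      intro j _
      have : ∀ y, (J j).indicator (1 : ℝ → ℝ≥0∞) y * N j y ^ m =
          (J j).indicator (fun y => N j y ^ m) y := fun y => by
        by_cases hy : y ∈ J j <;> simp [hy]
      simp_rw [this]
      rw [lintegral_indicator (hJm j), Measure.restrict_restrict (hJm j)]
      split_ifs with h
      · exact (lintegral_mono_set inter_subset_left).trans (ih j)
      · rw [inter_comm, not_nonempty_iff_eq_empty.1 h]
        simp
    calc ∫⁻ y in J i, N i y ^ (m + 1)
        ≤ ∫⁻ y in J i, (m + 1) * ∑ j ∈ s, (J j).indicator (1 : ℝ → ℝ≥0∞) y * N j y ^ m :=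
          lintegral_mono key
      _ = (m + 1) * ∑ j ∈ s, ∫⁻ y in J i, (J j).indicator (1 : ℝ → ℝ≥0∞) y * N j y ^ m := by
          have hmeas : ∀ j ∈ s, Measurable
              fun y => (J j).indicator (1 : ℝ → ℝ≥0∞) y * N j y ^ m := fun j _ =>
            (measurable_one.indicator (hJm j)).mul ((hN j).pow_const m)
          rw [lintegral_const_mul _ (Finset.measurable_fun_sum _ hmeas),
            lintegral_finsetSum _ hmeas]
      _ ≤ (m + 1) * ∑ j ∈ s, if (J i ∩ J j).Nonempty then
            (m.factorial * 6 ^ m : ℕ) * volume (J j) else 0 := by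
          gcongr with j hj
          exact hterm j hj
      _ = (m + 1) * ((m.factorial * 6 ^ m : ℕ) *
            ∑ j ∈ t with d j - c j ≤ d i - c i ∧ (J i ∩ J j).Nonempty, volume (J j)) := by
          rw [← Finset.sum_filter, Finset.filter_filter, ← Finset.mul_sum]
      _ ≤ (m + 1) * ((m.factorial * 6 ^ m : ℕ) * (6 * volume (J i))) := by
          gcongr
          exact sum_volume_le_of_sparse t c d E hE hEJ hJE hdisj i
      _ = ((m + 1).factorial * 6 ^ (m + 1) : ℕ) * volume (J i) := by
          rw [Nat.factorial_succ]; push_cast; ring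

/-- Córdoba–Fefferman selection: from finitely many rectangles, select a subfamily whose
vertical slices are sparse and which covers half of every vertical side of the original ones. -/
lemma exists_sparse_selection {ι : Type*} (s : Finset ι) (a b c d : ι → ℝ)
    (hab : ∀ i, a i < b i) :
    ∃ t ⊆ s,
      (∀ x, ∃ E : ι → Set ℝ, (∀ i ∈ t, x ∈ Ioo (a i) (b i) →
          MeasurableSet (E i) ∧ E i ⊆ Ioo (c i) (d i) ∧
            volume (Ioo (c i) (d i)) ≤ 2 * volume (E i)) ∧
        {i | i ∈ t ∧ x ∈ Ioo (a i) (b i)}.PairwiseDisjoint E) ∧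
      ∀ i ∈ s, volume (Ioo (c i) (d i)) ≤ 2 * volume (Ioo (c i) (d i) ∩
        ⋃ j ∈ {j | j ∈ t ∧ Ioo (a i) (b i) ⊆ Ioo (2 * a j - b j) (2 * b j - a j)},
          Ioo (c j) (d j)) := by
  classical
  induction s using Finset.induction_on_max_value (fun i => -(b i - a i)) with
  | empty => exact ⟨∅, by simp⟩
  | insert k s hk hmax ih =>
    obtain ⟨t, hts, hsparse, hcov⟩ := ih
    set K : Set ℝ := ⋃ j ∈ {j | j ∈ t ∧ (Ioo (a k) (b k) ∩ Ioo (a j) (b j)).Nonempty},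
      Ioo (c j) (d j) with hK
    have hKm : MeasurableSet K :=
      (isOpen_biUnion fun j _ => isOpen_Ioo).measurableSet
    by_cases hsel : volume (Ioo (c k) (d k)) ≤ 2 * volume (Ioo (c k) (d k) ∩ K)
    · refine ⟨t, hts.trans (Finset.subset_insert _ _), hsparse, fun i hi => ?_⟩
      rcases Finset.mem_insert.1 hi with rfl | hi
      · refine hsel.trans ?_
        gcongr
        refine biUnion_subset_biUnion_left fun j hj => ?_
        obtain ⟨hjt, z, hz1, hz2⟩ := hj
        have hlen := hmax j (hts hjt)
        refine ⟨hjt, fun x hx => ?_⟩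
        simp only [mem_Ioo] at *
        constructor <;> linarith
      · exact hcov i hi
    · refine ⟨insert k t, Finset.insert_subset_insert k hts, fun x => ?_, fun i hi => ?_⟩
      · obtain ⟨E, hE, hdisj⟩ := hsparse x
        have hkt : k ∉ t := fun h => hk (hts h)
        refine ⟨Function.update E k (Ioo (c k) (d k) \ K), fun i hi hx => ?_, ?_⟩
        · rcases Finset.mem_insert.1 hi with rfl | hit
          · rw [Function.update_self]
            refine ⟨measurableSet_Ioo.diff hKm, sdiff_subset, ?_⟩
            by_contra! hlt
            push Not at hsel
            have h := measure_inter_add_sdiff (μ := volume) (Ioo (c i) (d i)) hKm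
            have h2 := ENNReal.add_lt_add hsel hlt
            rw [← mul_add, h, two_mul] at h2
            exact lt_irrefl _ h2
          · rw [Function.update_of_ne (by rintro rfl; exact hkt hit)]
            exact hE i hit hx
        · have hnew : ∀ i ∈ t, x ∈ Ioo (a i) (b i) → x ∈ Ioo (a k) (b k) →
              Disjoint (Ioo (c k) (d k) \ K) (E i) := by
            intro i hi hx hxk
            refine disjoint_sdiff_left.mono_right (((hE i hi hx).2.1).trans ?_)
            exact subset_biUnion_of_mem (u := fun j => Ioo (c j) (d j)) ⟨hi, x, hxk, hx⟩
          rintro i ⟨hi, hxi⟩ j ⟨hj, hxj⟩ hij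
          rcases Finset.mem_insert.1 hi with rfl | hit <;>
          rcases Finset.mem_insert.1 hj with rfl | hjt
          · exact absurd rfl hij
          · simp only [Function.onFun]
            rw [Function.update_self, Function.update_of_ne hij.symm]
            exact hnew j hjt hxj hxi
          · simp only [Function.onFun]
            rw [Function.update_self, Function.update_of_ne hij]
            exact (hnew i hit hxi hxj).symm
          · simp only [Function.onFun]
            rw [Function.update_of_ne (by rintro rfl; exact hkt hit),
              Function.update_of_ne (by rintro rfl; exact hkt hjt)]
            exact hdisj ⟨hit, hxi⟩ ⟨hjt, hxj⟩ hij
      · rcases Finset.mem_insert.1 hi with rfl | hi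
        · have hsub : Ioo (c i) (d i) ⊆
              ⋃ j ∈ {j | j ∈ insert i t ∧
                Ioo (a i) (b i) ⊆ Ioo (2 * a j - b j) (2 * b j - a j)}, Ioo (c j) (d j) := by
            refine subset_biUnion_of_mem (u := fun j => Ioo (c j) (d j))
              ⟨Finset.mem_insert_self _ _, Ioo_subset_Ioo ?_ ?_⟩ <;> linarith [hab i]
          rw [inter_eq_left.2 hsub]
          exact le_mul_of_one_le_left (zero_le) (by norm_num)
        · refine (hcov i hi).trans ?_
          gcongr _ * volume (_ ∩ ?_)
          exact biUnion_subset_biUnion_left fun j hj => ⟨Finset.mem_insert_of_mem hj.1, hj.2⟩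

/-- The maximal operator over cubes acting on `ℝ≥0∞`-valued functions. -/
def MHL2e (g : ℝ × ℝ → ℝ≥0∞) (x : ℝ × ℝ) : ℝ≥0∞ :=
  ⨆ (Q : Set (ℝ × ℝ)) (_ : IsCube2 Q ∧ x ∈ Q), (∫⁻ y in Q, g y) / volume Q

lemma measurable_iSup_open {α : Type*} [TopologicalSpace α] [MeasurableSpace α] [BorelSpace α]
    (P : Set α → Prop) (hP : ∀ R, P R → IsOpen R) (φ : Set α → ℝ≥0∞) :
    Measurable fun x => ⨆ (R : Set α) (_ : P R ∧ x ∈ R), φ R := by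
  refine measurable_of_Ioi fun l => IsOpen.measurableSet ?_
  have : (fun x => ⨆ (R : Set α) (_ : P R ∧ x ∈ R), φ R) ⁻¹' Ioi l =
      ⋃₀ {R | P R ∧ l < φ R} := by
    ext x
    simp only [mem_preimage, mem_Ioi, lt_iSup_iff, mem_sUnion, mem_ofPred_eq]
    exact ⟨fun ⟨R, ⟨h1, h2⟩, h3⟩ => ⟨R, ⟨h1, h3⟩, h2⟩, fun ⟨R, ⟨h1, h3⟩, h2⟩ => ⟨R, ⟨h1, h2⟩, h3⟩⟩
  rw [this]
  exact isOpen_sUnion fun R hR => hP R hR.1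

lemma IsRect2.isOpen {R : Set (ℝ × ℝ)} (h : IsRect2 R) : IsOpen R := by
  obtain ⟨a₁, b₁, a₂, b₂, -, -, rfl⟩ := h
  exact isOpen_Ioo.prod isOpen_Ioo

lemma measurable_MR2e (g : ℝ × ℝ → ℝ≥0∞) : Measurable (MR2e g) :=
  measurable_iSup_open IsRect2 (fun _ => IsRect2.isOpen) _

lemma volume_Ioo_prod (a b c d : ℝ) :
    volume (Ioo a b ×ˢ Ioo c d : Set (ℝ × ℝ)) =
      ENNReal.ofReal (b - a) * ENNReal.ofReal (d - c) := by
  rw [Measure.volume_eq_prod, Measure.prod_prod, Real.volume_Ioo, Real.volume_Ioo]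

lemma volume_closedBall_prod (z : ℝ × ℝ) (r : ℝ) :
    volume (Metric.closedBall z r) = ENNReal.ofReal (2 * r) * ENNReal.ofReal (2 * r) := by
  rw [← Prod.mk.eta (p := z), ← closedBall_prod_same, Measure.volume_eq_prod, Measure.prod_prod,
    Real.volume_closedBall, Real.volume_closedBall]

lemma setLIntegral_closedBall_le (ω : ℝ × ℝ → ℝ≥0∞) (G : Set (ℝ × ℝ)) (hG : MeasurableSet G)
    (z : ℝ × ℝ) (r : ℝ) (hr : 0 < r)
    (hz : volume (Metric.closedBall z r) ≤ 2 * volume (Metric.closedBall z r ∩ G)) :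
    ∫⁻ y in Metric.closedBall z (5 * r), ω y ≤
      72 * ∫⁻ y in Metric.closedBall z r ∩ G, MHL2e ω y := by
  set B := Metric.closedBall z r with hB
  set Q : Set (ℝ × ℝ) := Ioo (z.1 - 6 * r) (z.1 - 6 * r + 12 * r) ×ˢ
    Ioo (z.2 - 6 * r) (z.2 - 6 * r + 12 * r) with hQ
  have hQc : IsCube2 Q := ⟨_, _, 12 * r, by positivity, rfl⟩
  have hsub : ∀ ρ ≤ 5 * r, Metric.closedBall z ρ ⊆ Q := by
    intro ρ hρ y hy
    rw [← Prod.mk.eta (p := z), ← closedBall_prod_same, Real.closedBall_eq_Icc,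
      Real.closedBall_eq_Icc] at hy
    simp only [mem_prod, mem_Icc] at hy
    simp only [hQ, mem_prod, mem_Ioo]
    refine ⟨⟨?_, ?_⟩, ?_, ?_⟩ <;> linarith
  have hvB : volume B = ENNReal.ofReal (4 * r ^ 2) := by
    rw [hB, volume_closedBall_prod, ← ENNReal.ofReal_mul (by positivity)]
    ring_nf
  have hvQ : volume Q = 36 * volume B := by
    rw [hvB, hQ, volume_Ioo_prod, ← ENNReal.ofReal_mul (by linarith),
      show (36 : ℝ≥0∞) = ENNReal.ofReal 36 by simp, ← ENNReal.ofReal_mul (by norm_num)]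
    ring_nf
  have hB0 : volume B ≠ 0 := by rw [hvB]; simp; positivity
  have hBt : volume B ≠ ⊤ := by rw [hvB]; exact ENNReal.ofReal_ne_top
  have hQ0 : volume Q ≠ 0 := by rw [hvQ]; simp [hB0]
  have hQt : volume Q ≠ ⊤ := by rw [hvQ]; exact ENNReal.mul_ne_top (by simp) hBt
  calc ∫⁻ y in Metric.closedBall z (5 * r), ω y ≤ ∫⁻ y in Q, ω y :=
        lintegral_mono_set (hsub _ le_rfl)
    _ = (∫⁻ y in Q, ω y) / volume Q * volume Q := (ENNReal.div_mul_cancel hQ0 hQt).symm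
    _ ≤ (∫⁻ y in Q, ω y) / volume Q * (36 * (2 * volume (B ∩ G))) := by
        rw [hvQ]; gcongr
    _ = 72 * ∫⁻ _ in B ∩ G, (∫⁻ y in Q, ω y) / volume Q := by
        rw [setLIntegral_const]; ring
    _ ≤ 72 * ∫⁻ y in B ∩ G, MHL2e ω y := by
        gcongr 72 * ?_
        refine setLIntegral_mono' (measurableSet_closedBall.inter hG) fun y hy => ?_
        exact le_iSup₂_of_le Q ⟨hQc, hsub r (by linarith) hy.1⟩ le_rfl

/-- Fefferman–Stein weak type estimate for the cube maximal operator, for sets covered by cubes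
of bounded size that lie at least half in `G`. -/
lemma setLIntegral_le_of_cubes (ω : ℝ × ℝ → ℝ≥0∞) (A G : Set (ℝ × ℝ)) (hG : MeasurableSet G)
    (R : ℝ) (hA : ∀ x ∈ A, ∃ z r, 0 < r ∧ r ≤ R ∧ x ∈ Metric.closedBall z r ∧
      volume (Metric.closedBall z r) ≤ 2 * volume (Metric.closedBall z r ∩ G)) :
    ∫⁻ x in A, ω x ≤ 72 * ∫⁻ x in G, MHL2e ω x := by
  let t : Set ((ℝ × ℝ) × ℝ) := {q | 0 < q.2 ∧ q.2 ≤ R ∧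
    volume (Metric.closedBall q.1 q.2) ≤ 2 * volume (Metric.closedBall q.1 q.2 ∩ G)}
  obtain ⟨u, hut, hdisj, hcov⟩ := Vitali.exists_disjoint_subfamily_covering_enlargement_closedBall
    t (fun q => q.1) (fun q => q.2) R (fun q hq => hq.2.1) 5 (by norm_num)
  have hu : u.Countable := hdisj.countable_of_nonempty_interior fun q hq =>
    ⟨q.1, Metric.ball_subset_interior_closedBall (Metric.mem_ball_self (hut hq).1)⟩
  have hAsub : A ⊆ ⋃ q ∈ u, Metric.closedBall q.1 (5 * q.2) := by
    intro x hx
    obtain ⟨z, r, h0, hR, hxz, hv⟩ := hA x hx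
    obtain ⟨q, hq, hsub⟩ := hcov (z, r) ⟨h0, hR, hv⟩
    exact mem_biUnion hq (hsub hxz)
  have := hu.to_subtype
  calc ∫⁻ x in A, ω x ≤ ∫⁻ x in ⋃ q ∈ u, Metric.closedBall q.1 (5 * q.2), ω x :=
        lintegral_mono_set hAsub
    _ ≤ ∑' q : u, ∫⁻ x in Metric.closedBall q.1.1 (5 * q.1.2), ω x := by
        rw [biUnion_eq_iUnion]
        exact lintegral_iUnion_le _ _
    _ ≤ ∑' q : u, 72 * ∫⁻ x in Metric.closedBall q.1.1 q.1.2 ∩ G, MHL2e ω x :=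
        ENNReal.tsum_le_tsum fun q =>
          setLIntegral_closedBall_le ω G hG _ _ (hut q.2).1 (hut q.2).2.2
    _ = 72 * ∫⁻ x in ⋃ q ∈ u, Metric.closedBall q.1 q.2 ∩ G, MHL2e ω x := by
        rw [ENNReal.tsum_mul_left, lintegral_biUnion hu
          (fun q _ => measurableSet_closedBall.inter hG)
          (hdisj.mono fun q => inter_subset_left)]
    _ ≤ 72 * ∫⁻ x in G, MHL2e ω x := by
        gcongr
        exact iUnion₂_subset fun q _ => inter_subset_right

/-- In a rectangle wider than tall, half of whose vertical side lies in `S`, every point belongs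
to a square with half of its mass over `S`. -/
lemma exists_closedBall_of_wide {a b c d : ℝ} (hcd : c < d) (hw : d - c ≤ b - a) (S : Set ℝ)
    (hS : volume (Ioo c d) ≤ 2 * volume (Ioo c d ∩ S)) (G : Set (ℝ × ℝ))
    (hG : Ioo a b ×ˢ (Ioo c d ∩ S) ⊆ G) (x : ℝ × ℝ) (hx : x ∈ Ioo a b ×ˢ Ioo c d) :
    ∃ z : ℝ × ℝ, x ∈ Metric.closedBall z ((d - c) / 2) ∧
      volume (Metric.closedBall z ((d - c) / 2)) ≤
        2 * volume (Metric.closedBall z ((d - c) / 2) ∩ G) := by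
  obtain ⟨⟨hx1, hx2⟩, hx3, hx4⟩ := hx
  set r := (d - c) / 2 with hr
  obtain ⟨ζ, h1, h2, h3, h4⟩ : ∃ ζ, a ≤ ζ - r ∧ ζ + r ≤ b ∧ ζ - r ≤ x.1 ∧ x.1 ≤ ζ + r := by
    rcases le_total x.1 (a + r) with h | h
    · exact ⟨a + r, by linarith, by linarith, by linarith, by linarith⟩
    rcases le_total x.1 (b - r) with h' | h'
    · exact ⟨x.1, by linarith, by linarith, by linarith, by linarith⟩
    · exact ⟨b - r, by linarith, by linarith, by linarith, by linarith⟩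
  have hball : Metric.closedBall (ζ, (c + d) / 2) r = Icc (ζ - r) (ζ + r) ×ˢ Icc c d := by
    rw [← closedBall_prod_same, Real.closedBall_eq_Icc, Real.closedBall_eq_Icc]
    congr 2 <;> rw [hr] <;> ring
  refine ⟨(ζ, (c + d) / 2), ?_, ?_⟩
  · rw [hball]
    exact ⟨⟨h3, h4⟩, hx3.le, hx4.le⟩
  · have hsub : Ioo (ζ - r) (ζ + r) ×ˢ (Ioo c d ∩ S) ⊆
        Metric.closedBall (ζ, (c + d) / 2) r ∩ G := by
      refine subset_inter ?_ (Subset.trans (prod_mono (Ioo_subset_Ioo h1 h2) Subset.rfl) hG)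
      rw [hball]
      exact prod_mono Ioo_subset_Icc_self (inter_subset_left.trans Ioo_subset_Icc_self)
    calc volume (Metric.closedBall (ζ, (c + d) / 2) r)
        = volume (Ioo (ζ - r) (ζ + r)) * volume (Ioo c d) := by
          rw [volume_closedBall_prod, Real.volume_Ioo, Real.volume_Ioo]
          congr 2 <;> rw [hr] <;> ring
      _ ≤ volume (Ioo (ζ - r) (ζ + r)) * (2 * volume (Ioo c d ∩ S)) := by gcongr
      _ = 2 * volume (Ioo (ζ - r) (ζ + r) ×ˢ (Ioo c d ∩ S)) := by
          rw [Measure.volume_eq_prod, Measure.prod_prod]; ring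
      _ ≤ _ := by gcongr

/-- Two-dimensional moments of the overlap function of a family with sparse vertical slices. -/
lemma lintegral_rect_overlap_pow_le {ι : Type*} (t : Finset ι) (a b c d : ι → ℝ)
    (hsparse : ∀ x, ∃ E : ι → Set ℝ, (∀ i ∈ t, x ∈ Ioo (a i) (b i) →
          MeasurableSet (E i) ∧ E i ⊆ Ioo (c i) (d i) ∧
            volume (Ioo (c i) (d i)) ≤ 2 * volume (E i)) ∧
        {i | i ∈ t ∧ x ∈ Ioo (a i) (b i)}.PairwiseDisjoint E) (m : ℕ) (i : ι) :
    ∫⁻ z : ℝ × ℝ, (Ioo (a i) (b i) ×ˢ Ioo (c i) (d i)).indicator 1 z *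
      (∑ j ∈ t with d j - c j ≤ d i - c i,
        (Ioo (a j) (b j) ×ˢ Ioo (c j) (d j)).indicator (1 : ℝ × ℝ → ℝ≥0∞) z) ^ m
      ≤ (m.factorial * 6 ^ m : ℕ) * volume (Ioo (a i) (b i) ×ˢ Ioo (c i) (d i)) := by
  classical
  have hRm : ∀ i, MeasurableSet (Ioo (a i) (b i) ×ˢ Ioo (c i) (d i)) := fun i =>
    measurableSet_Ioo.prod measurableSet_Ioo
  have hmeas : Measurable fun z : ℝ × ℝ =>
      (Ioo (a i) (b i) ×ˢ Ioo (c i) (d i)).indicator (1 : ℝ × ℝ → ℝ≥0∞) z *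
        (∑ j ∈ t with d j - c j ≤ d i - c i,
          (Ioo (a j) (b j) ×ˢ Ioo (c j) (d j)).indicator (1 : ℝ × ℝ → ℝ≥0∞) z) ^ m :=
    (measurable_one.indicator (hRm i)).mul
    ((measurable_sum_indicator (t.filter fun j => d j - c j ≤ d i - c i) _ hRm).pow_const m)
  rw [Measure.volume_eq_prod, lintegral_prod _ hmeas.aemeasurable, Measure.prod_prod]
  have hslice : ∀ x, ∫⁻ y, (Ioo (a i) (b i) ×ˢ Ioo (c i) (d i)).indicator 1 (x, y) *
      (∑ j ∈ t with d j - c j ≤ d i - c i,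
        (Ioo (a j) (b j) ×ˢ Ioo (c j) (d j)).indicator (1 : ℝ × ℝ → ℝ≥0∞) (x, y)) ^ m ≤
      (Ioo (a i) (b i)).indicator
        (fun _ => (m.factorial * 6 ^ m : ℕ) * volume (Ioo (c i) (d i))) x := by
    intro x
    by_cases hx : x ∈ Ioo (a i) (b i)
    · obtain ⟨E, hE, hdisj⟩ := hsparse x
      let tx := t.filter fun j => x ∈ Ioo (a j) (b j)
      have htx : ∀ j ∈ tx, j ∈ t ∧ x ∈ Ioo (a j) (b j) := fun j hj => Finset.mem_filter.1 hj
      have := lintegral_overlap_pow_le tx c d E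
        (fun j hj => (hE j (htx j hj).1 (htx j hj).2).1)
        (fun j hj => (hE j (htx j hj).1 (htx j hj).2).2.1)
        (fun j hj => (hE j (htx j hj).1 (htx j hj).2).2.2)
        (hdisj.subset fun j hj => htx j hj) m i
      rw [indicator_of_mem hx]
      refine le_trans (le_of_eq ?_) this
      rw [← lintegral_indicator measurableSet_Ioo]
      refine lintegral_congr fun y => ?_
      by_cases hy : y ∈ Ioo (c i) (d i)
      · rw [indicator_of_mem (mk_mem_prod hx hy), indicator_of_mem hy, Pi.one_apply, one_mul,
          Finset.filter_comm, Finset.sum_filter (p := fun j => x ∈ Ioo (a j) (b j))]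
        congr 1
        refine Finset.sum_congr rfl fun j _ => ?_
        by_cases hj : x ∈ Ioo (a j) (b j)
        · rw [if_pos hj]
          simp only [indicator, mem_prod, hj, true_and, Pi.one_apply]
        · rw [if_neg hj, indicator_of_notMem fun h => hj h.1]
      · rw [indicator_of_notMem fun h => hy h.2, indicator_of_notMem hy, zero_mul]
    · rw [indicator_of_notMem hx]
      refine (lintegral_eq_zero_of_ae_eq_zero (Filter.Eventually.of_forall fun y => ?_)).le
      rw [indicator_of_notMem fun h => hx h.1, zero_mul]
      rfl
  refine (lintegral_mono hslice).trans ?_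
  rw [lintegral_indicator measurableSet_Ioo, setLIntegral_const]
  exact le_of_eq (by ring)

lemma sum_lintegral_le {α ι : Type*} [MeasurableSpace α] {μ : Measure α} (s : Finset ι)
    (h : ι → α → ℝ≥0∞) : ∑ i ∈ s, ∫⁻ x, h i x ∂μ ≤ ∫⁻ x, ∑ i ∈ s, h i x ∂μ := by
  classical
  induction s using Finset.induction_on with
  | empty => simp
  | insert a s ha ih =>
    simp_rw [Finset.sum_insert ha]
    exact (add_le_add_right ih _).trans (le_lintegral_add _ _)

lemma tsum_lintegral_le {α ι : Type*} [MeasurableSpace α] {μ : Measure α}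
    (h : ι → α → ℝ≥0∞) : ∑' i, ∫⁻ x, h i x ∂μ ≤ ∫⁻ x, ∑' i, h i x ∂μ := by
  rw [ENNReal.tsum_eq_iSup_sum]
  exact iSup_le fun s => (sum_lintegral_le s h).trans
    (lintegral_mono fun x => ENNReal.sum_le_tsum s)

/-- A weighted Young inequality. -/
lemma mul_le_young (m : ℕ) (hm : m ≠ 0) (K g φ ψ W : ℝ≥0∞) (hK0 : K ≠ 0) (hKt : K ≠ ⊤)
    (hφ : W ≠ ⊤ → φ = W * ψ) :
    g * φ ≤ K⁻¹ * (φ * ψ ^ m) + K ^ (m : ℝ)⁻¹ * (g ^ (1 + (m : ℝ)⁻¹) * W) := by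
  have hm' : (0 : ℝ) < m := by exact_mod_cast Nat.pos_of_ne_zero hm
  have hmi : (0 : ℝ) < (m : ℝ)⁻¹ := inv_pos.2 hm'
  rcases le_total (K * g) (ψ ^ m) with h | h
  · calc g * φ = K⁻¹ * (φ * (K * g)) := by
          rw [show K⁻¹ * (φ * (K * g)) = (K⁻¹ * K) * (g * φ) by ring,
            ENNReal.inv_mul_cancel hK0 hKt, one_mul]
      _ ≤ K⁻¹ * (φ * ψ ^ m) := by gcongr
      _ ≤ _ := le_self_add
  · refine le_trans ?_ le_add_self
    by_cases hW : W = ⊤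
    · rcases eq_or_ne g 0 with rfl | hg
      · simp
      · have h1 : K ^ (m : ℝ)⁻¹ ≠ 0 := by simp [ENNReal.rpow_eq_zero_iff, hK0, hKt]
        have h2 : g ^ (1 + (m : ℝ)⁻¹) ≠ 0 := by
          have : 0 < 1 + (m : ℝ)⁻¹ := by positivity
          simp [ENNReal.rpow_eq_zero_iff, hg, not_lt.2 this.le]
        rw [hW, ENNReal.mul_top h2, ENNReal.mul_top h1]
        exact le_top
    · have hψ : ψ ≤ (K * g) ^ (m : ℝ)⁻¹ := by
        rw [ENNReal.le_rpow_inv_iff hm', ENNReal.rpow_natCast]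
        exact h
      calc g * φ ≤ g * (W * (K * g) ^ (m : ℝ)⁻¹) := by rw [hφ hW]; gcongr
        _ = K ^ (m : ℝ)⁻¹ * (g ^ (1 + (m : ℝ)⁻¹) * W) := by
          rw [ENNReal.mul_rpow_of_nonneg _ _ hmi.le,
            ENNReal.rpow_add_of_nonneg _ _ zero_le_one hmi.le, ENNReal.rpow_one]
          ring

/-- Constant in the moment estimate for sparse families. -/
def sparseConst (m : ℕ) : ℝ≥0∞ := (((m + 1) * (m.factorial * 6 ^ m) : ℕ) : ℝ≥0∞)

lemma sparseConst_ne_zero (m : ℕ) : sparseConst m ≠ 0 := by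
  rw [sparseConst, Nat.cast_ne_zero]
  positivity

lemma sparseConst_ne_top (m : ℕ) : sparseConst m ≠ ⊤ := ENNReal.natCast_ne_top _

lemma sum_mul_volume_le_of_sparse_nnreal {ι : Type*} (t : Finset ι) (a b c d : ι → ℝ)
    (hsparse : ∀ x, ∃ E : ι → Set ℝ, (∀ i ∈ t, x ∈ Ioo (a i) (b i) →
          MeasurableSet (E i) ∧ E i ⊆ Ioo (c i) (d i) ∧
            volume (Ioo (c i) (d i)) ≤ 2 * volume (E i)) ∧
        {i | i ∈ t ∧ x ∈ Ioo (a i) (b i)}.PairwiseDisjoint E)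
    (m : ℕ) (hm : m ≠ 0) (μ : ι → NNReal) (g W : ℝ × ℝ → ℝ≥0∞) (hW : Measurable W)
    (hμW : ∀ i ∈ t, ∀ z ∈ Ioo (a i) (b i) ×ˢ Ioo (c i) (d i), (μ i : ℝ≥0∞) ≤ W z)
    (hg : ∀ i ∈ t, volume (Ioo (a i) (b i) ×ˢ Ioo (c i) (d i)) ≤
      ∫⁻ z in Ioo (a i) (b i) ×ˢ Ioo (c i) (d i), g z) :
    ∑ i ∈ t, μ i * volume (Ioo (a i) (b i) ×ˢ Ioo (c i) (d i)) ≤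
      2 * (2 * sparseConst m) ^ (m : ℝ)⁻¹ * ∫⁻ z, g z ^ (1 + (m : ℝ)⁻¹) * W z := by
  set R : ι → Set (ℝ × ℝ) := fun i => Ioo (a i) (b i) ×ˢ Ioo (c i) (d i) with hR
  have hRm : ∀ i, MeasurableSet (R i) := fun i => measurableSet_Ioo.prod measurableSet_Ioo
  let χ : ι → ℝ × ℝ → ℝ≥0∞ := fun i => (R i).indicator 1
  have hχ : ∀ i, Measurable (χ i) := fun i => measurable_one.indicator (hRm i)
  let N : ι → ℝ × ℝ → ℝ≥0∞ := fun i z => ∑ j ∈ t with d j - c j ≤ d i - c i, χ j z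
  have hN : ∀ i, Measurable (N i) := fun i => measurable_sum_indicator _ _ hRm
  let φ : ℝ × ℝ → ℝ≥0∞ := fun z => ∑ i ∈ t, μ i * χ i z
  let ψ : ℝ × ℝ → ℝ≥0∞ := fun z => ∑ i ∈ t, μ i / W z * χ i z
  have hφm : Measurable φ := Finset.measurable_fun_sum _ fun i _ => (hχ i).const_mul _
  have hψm : Measurable ψ := Finset.measurable_fun_sum _ fun i _ =>
    (measurable_const.div hW).mul (hχ i)
  have hterm : ∀ z, W z ≠ ⊤ → ∀ i ∈ t, μ i * χ i z = W z * (μ i / W z * χ i z) := by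
    intro z hz i hi
    by_cases hzi : z ∈ R i
    · rw [← mul_assoc]
      rcases eq_or_ne (W z) 0 with h0 | h0
      · have := hμW i hi z hzi
        rw [h0, nonpos_iff_eq_zero] at this
        simp [this]
      · rw [ENNReal.mul_div_cancel h0 hz]
    · simp [χ, hzi]
  have hφψ : ∀ z, W z ≠ ⊤ → φ z = W z * ψ z := by
    intro z hz
    simp only [φ, ψ]
    rw [Finset.mul_sum]
    exact Finset.sum_congr rfl (hterm z hz)
  have hle : ∀ z, ∀ i ∈ t, μ i / W z * χ i z ≤ χ i z := by
    intro z i hi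
    by_cases hzi : z ∈ R i
    · exact mul_le_of_le_one_left zero_le (ENNReal.div_le_of_le_mul (by simpa using hμW i hi z hzi))
    · simp [χ, hzi]
  have hpoint : ∀ z, φ z * ψ z ^ m ≤ (m + 1) * ∑ i ∈ t, μ i * (χ i z * N i z ^ m) := by
    intro z
    by_cases hz : W z = ⊤
    · have : ψ z = 0 := by simp [ψ, hz]
      rw [this, zero_pow hm, mul_zero]
      exact zero_le
    · calc φ z * ψ z ^ m = W z * ψ z ^ (m + 1) := by rw [hφψ z hz]; ring
        _ ≤ W z * ((m + 1) * ∑ i ∈ t, μ i / W z * χ i z *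
            (∑ j ∈ t with d j - c j ≤ d i - c i, μ j / W z * χ j z) ^ m) := by
          gcongr
          exact sum_pow_succ_le t (fun i => d i - c i) _ m
        _ ≤ W z * ((m + 1) * ∑ i ∈ t, μ i / W z * χ i z * N i z ^ m) := by
          gcongr with i _
          exact Finset.sum_le_sum fun j hj => hle z j (Finset.mem_filter.1 hj).1
        _ = (m + 1) * ∑ i ∈ t, μ i * (χ i z * N i z ^ m) := by
          rw [mul_left_comm, Finset.mul_sum]
          congr 1
          refine Finset.sum_congr rfl fun i hi => ?_
          rw [← mul_assoc, ← hterm z hz i hi, mul_assoc]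
  set A : ℝ≥0∞ := ∑ i ∈ t, μ i * volume (R i) with hA
  have hAt : A ≠ ⊤ := by
    refine ENNReal.sum_ne_top.2 fun i _ => ENNReal.mul_ne_top ENNReal.coe_ne_top ?_
    rw [volume_Ioo_prod]
    exact ENNReal.mul_ne_top ENNReal.ofReal_ne_top ENNReal.ofReal_ne_top
  have hmoment : ∫⁻ z, φ z * ψ z ^ m ≤ sparseConst m * A := by
    have hmeas : ∀ i ∈ t, Measurable fun z => (μ i : ℝ≥0∞) * (χ i z * N i z ^ m) := fun i _ =>
      ((hχ i).mul ((hN i).pow_const m)).const_mul _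
    calc ∫⁻ z, φ z * ψ z ^ m
        ≤ ∫⁻ z, (m + 1) * ∑ i ∈ t, μ i * (χ i z * N i z ^ m) := lintegral_mono hpoint
      _ = (m + 1) * ∑ i ∈ t, μ i * ∫⁻ z, χ i z * N i z ^ m := by
          rw [lintegral_const_mul _ (Finset.measurable_fun_sum _ hmeas),
            lintegral_finsetSum _ hmeas]
          congr 1
          exact Finset.sum_congr rfl fun i _ =>
            lintegral_const_mul _ ((hχ i).mul ((hN i).pow_const m))
      _ ≤ (m + 1) * ∑ i ∈ t, μ i * ((m.factorial * 6 ^ m : ℕ) * volume (R i)) := by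
          gcongr with i _
          exact lintegral_rect_overlap_pow_le t a b c d hsparse m i
      _ = sparseConst m * A := by
          rw [hA, sparseConst, Finset.mul_sum, Finset.mul_sum]
          refine Finset.sum_congr rfl fun i _ => ?_
          push_cast
          ring
  set K := 2 * sparseConst m with hK
  have hK0 : K ≠ 0 := mul_ne_zero two_ne_zero (sparseConst_ne_zero m)
  have hKt : K ≠ ⊤ := ENNReal.mul_ne_top (by simp) (sparseConst_ne_top m)
  set X := K ^ (m : ℝ)⁻¹ * ∫⁻ z, g z ^ (1 + (m : ℝ)⁻¹) * W z with hX
  have hmain : A ≤ A / 2 + X := by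
    calc A ≤ ∑ i ∈ t, μ i * ∫⁻ z in R i, g z := by
          rw [hA]
          gcongr with i hi
          exact hg i hi
      _ = ∑ i ∈ t, ∫⁻ z, μ i * (R i).indicator g z := by
          refine Finset.sum_congr rfl fun i _ => ?_
          rw [lintegral_const_mul' _ _ ENNReal.coe_ne_top, lintegral_indicator (hRm i)]
      _ ≤ ∫⁻ z, ∑ i ∈ t, μ i * (R i).indicator g z := sum_lintegral_le _ _
      _ = ∫⁻ z, g z * φ z := by
          refine lintegral_congr fun z => ?_
          simp only [φ]
          rw [Finset.mul_sum]
          refine Finset.sum_congr rfl fun i _ => ?_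
          by_cases hzi : z ∈ R i <;> simp [χ, hzi, mul_comm]
      _ ≤ ∫⁻ z, K⁻¹ * (φ z * ψ z ^ m) + K ^ (m : ℝ)⁻¹ * (g z ^ (1 + (m : ℝ)⁻¹) * W z) :=
          lintegral_mono fun z => mul_le_young m hm K _ _ _ _ hK0 hKt (hφψ z)
      _ = K⁻¹ * (∫⁻ z, φ z * ψ z ^ m) + X := by
          have hmeas : Measurable fun z => φ z * ψ z ^ m := hφm.mul (hψm.pow_const m)
          rw [lintegral_add_left (hmeas.const_mul _), lintegral_const_mul _ hmeas,
            lintegral_const_mul' _ _ (ENNReal.rpow_ne_top_of_nonneg (by positivity) hKt)]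
      _ ≤ K⁻¹ * (sparseConst m * A) + X := by gcongr
      _ = A / 2 + X := by
          rw [hK, ENNReal.mul_inv (by simp) (by simp), ← mul_assoc, mul_assoc 2⁻¹,
            ENNReal.inv_mul_cancel (sparseConst_ne_zero m) (sparseConst_ne_top m), mul_one,
            ENNReal.div_eq_inv_mul]
  have hhalf : A / 2 ≤ X := by
    have h2 : A / 2 ≠ ⊤ := ENNReal.div_ne_top hAt (by simp)
    refine (ENNReal.add_le_add_iff_left h2).1 ?_
    rwa [ENNReal.add_halves]
  calc A = 2 * (A / 2) := by rw [ENNReal.mul_div_cancel (by simp) (by simp)]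
    _ ≤ 2 * X := by gcongr
    _ = _ := by rw [hX, mul_assoc]

/-- The dual estimate behind the covering argument: a sparse family of rectangles on which `g`
has large averages is controlled by an `L^q(W)` norm of `g`, for `W` dominating the
coefficients. -/
lemma sum_mul_volume_le_of_sparse {ι : Type*} (t : Finset ι) (a b c d : ι → ℝ)
    (hsparse : ∀ x, ∃ E : ι → Set ℝ, (∀ i ∈ t, x ∈ Ioo (a i) (b i) →
          MeasurableSet (E i) ∧ E i ⊆ Ioo (c i) (d i) ∧
            volume (Ioo (c i) (d i)) ≤ 2 * volume (E i)) ∧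
        {i | i ∈ t ∧ x ∈ Ioo (a i) (b i)}.PairwiseDisjoint E)
    (m : ℕ) (hm : m ≠ 0) (μ : ι → ℝ≥0∞) (g W : ℝ × ℝ → ℝ≥0∞) (hW : Measurable W)
    (hμW : ∀ i ∈ t, ∀ z ∈ Ioo (a i) (b i) ×ˢ Ioo (c i) (d i), μ i ≤ W z)
    (hg : ∀ i ∈ t, volume (Ioo (a i) (b i) ×ˢ Ioo (c i) (d i)) ≤
      ∫⁻ z in Ioo (a i) (b i) ×ˢ Ioo (c i) (d i), g z) :
    ∑ i ∈ t, μ i * volume (Ioo (a i) (b i) ×ˢ Ioo (c i) (d i)) ≤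
      2 * (2 * sparseConst m) ^ (m : ℝ)⁻¹ * ∫⁻ z, g z ^ (1 + (m : ℝ)⁻¹) * W z := by
  have hlim : Filter.Tendsto
      (fun n : ℕ => ∑ i ∈ t, min (μ i) n * volume (Ioo (a i) (b i) ×ˢ Ioo (c i) (d i)))
      Filter.atTop
      (nhds (∑ i ∈ t, min (μ i) ⊤ * volume (Ioo (a i) (b i) ×ˢ Ioo (c i) (d i)))) := by
    refine tendsto_finsetSum _ fun i _ => ENNReal.Tendsto.mul_const
      (tendsto_const_nhds.min ENNReal.tendsto_nat_nhds_top) (Or.inr ?_)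
    rw [volume_Ioo_prod]
    exact ENNReal.mul_ne_top ENNReal.ofReal_ne_top ENNReal.ofReal_ne_top
  simp only [min_top_right] at hlim
  refine le_of_tendsto' hlim fun n => ?_
  have hfin : ∀ i, min (μ i) n ≠ ⊤ := fun i =>
    ((min_le_right _ _).trans_lt (ENNReal.natCast_lt_top n)).ne
  have := sum_mul_volume_le_of_sparse_nnreal t a b c d hsparse m hm
    (fun i => (min (μ i) n).toNNReal) g W hW (fun i hi z hz => by
      rw [ENNReal.coe_toNNReal (hfin i)]
      exact (min_le_left _ _).trans (hμW i hi z hz)) hg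
  simpa only [ENNReal.coe_toNNReal (hfin _)] using this

/-- Constant in the weak type estimate for rectangles of one orientation. -/
def weakConst (m : ℕ) : ℝ≥0∞ := 432 * (2 * sparseConst m) ^ (m : ℝ)⁻¹

lemma weakConst_ne_top (m : ℕ) : weakConst m ≠ ⊤ :=
  ENNReal.mul_ne_top (by simp) (ENNReal.rpow_ne_top_of_nonneg (by positivity)
    (ENNReal.mul_ne_top (by simp) (sparseConst_ne_top m)))

lemma setLIntegral_wide_rects_le {ι : Type*} (s : Finset ι) (a b c d : ι → ℝ)
    (hab : ∀ i, a i < b i) (hcd : ∀ i, c i < d i) (hw : ∀ i ∈ s, d i - c i ≤ b i - a i)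
    (m : ℕ) (hm : m ≠ 0) (ω g : ℝ × ℝ → ℝ≥0∞)
    (hg : ∀ i ∈ s, volume (Ioo (a i) (b i) ×ˢ Ioo (c i) (d i)) ≤
      ∫⁻ z in Ioo (a i) (b i) ×ˢ Ioo (c i) (d i), g z) :
    ∫⁻ z in ⋃ i ∈ s, Ioo (a i) (b i) ×ˢ Ioo (c i) (d i), ω z ≤
      weakConst m * ∫⁻ z, g z ^ (1 + (m : ℝ)⁻¹) * MR2e (MHL2e ω) z := by
  classical
  obtain ⟨t, hts, hsparse, hcov⟩ := exists_sparse_selection s a b c d hab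
  set Rs : ι → Set (ℝ × ℝ) := fun j =>
    Ioo (2 * a j - b j) (2 * b j - a j) ×ˢ Ioo (c j) (d j) with hRs
  set R : ι → Set (ℝ × ℝ) := fun i => Ioo (a i) (b i) ×ˢ Ioo (c i) (d i) with hR
  set G : Set (ℝ × ℝ) := ⋃ j ∈ t, Rs j with hGdef
  have hG : MeasurableSet G := t.measurableSet_biUnion fun j _ =>
    measurableSet_Ioo.prod measurableSet_Ioo
  have hvol : ∀ j, volume (Rs j) = 3 * volume (R j) := by
    intro j
    rw [hRs, hR, volume_Ioo_prod, volume_Ioo_prod,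
      show 2 * b j - a j - (2 * a j - b j) = 3 * (b j - a j) by ring,
      ENNReal.ofReal_mul (by norm_num), mul_assoc]
    norm_num
  have hvol0 : ∀ j, volume (Rs j) ≠ 0 := by
    intro j
    rw [hRs, volume_Ioo_prod]
    have := hab j
    have := hcd j
    simp only [ne_eq, mul_eq_zero, ENNReal.ofReal_eq_zero, not_or, not_le]
    constructor <;> linarith
  have hvolt : ∀ j, volume (Rs j) ≠ ⊤ := by
    intro j
    rw [hRs, volume_Ioo_prod]
    exact ENNReal.mul_ne_top ENNReal.ofReal_ne_top ENNReal.ofReal_ne_top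
  obtain ⟨ρ, hρ⟩ : ∃ ρ, ∀ i ∈ s, (d i - c i) / 2 ≤ ρ := by
    obtain ⟨ρ, hρ⟩ := (s.image fun i => (d i - c i) / 2).bddAbove
    exact ⟨ρ, fun i hi => hρ (Finset.mem_coe.2 (Finset.mem_image_of_mem _ hi))⟩
  have hcubes : ∀ x ∈ ⋃ i ∈ s, R i, ∃ z r, 0 < r ∧ r ≤ ρ ∧ x ∈ Metric.closedBall z r ∧
      volume (Metric.closedBall z r) ≤ 2 * volume (Metric.closedBall z r ∩ G) := by
    intro x hx
    obtain ⟨i, hi, hxi⟩ := mem_iUnion₂.1 hx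
    obtain ⟨z, hz⟩ := exists_closedBall_of_wide (hcd i) (hw i hi) _ (hcov i hi) G (by
      rintro y ⟨hy1, -, hy2⟩
      obtain ⟨j, ⟨hjt, hj⟩, hyj⟩ := mem_iUnion₂.1 hy2
      exact mem_biUnion hjt ⟨hj hy1, hyj⟩) x hxi
    exact ⟨z, (d i - c i) / 2, by linarith [hcd i], hρ i hi, hz⟩
  let μ : ι → ℝ≥0∞ := fun j => (∫⁻ z in Rs j, MHL2e ω z) / volume (Rs j)
  calc ∫⁻ z in ⋃ i ∈ s, R i, ω z ≤ 72 * ∫⁻ z in G, MHL2e ω z :=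
        setLIntegral_le_of_cubes ω _ G hG ρ hcubes
    _ ≤ 72 * ∑ j ∈ t, ∫⁻ z in Rs j, MHL2e ω z := by
        gcongr
        have h := lintegral_iUnion_le (μ := volume) (fun j : t => Rs j) (MHL2e ω)
        rw [tsum_fintype, Finset.sum_coe_sort t fun j => ∫⁻ z in Rs j, MHL2e ω z] at h
        rwa [Set.iUnion_subtype (fun j => j ∈ t) fun j => Rs j] at h
    _ = 72 * ∑ j ∈ t, 3 * (μ j * volume (R j)) := by
        congr 1
        refine Finset.sum_congr rfl fun j _ => ?_
        rw [mul_left_comm, ← hvol j, ENNReal.div_mul_cancel (hvol0 j) (hvolt j)]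
    _ ≤ 72 * (3 * (2 * (2 * sparseConst m) ^ (m : ℝ)⁻¹ *
          ∫⁻ z, g z ^ (1 + (m : ℝ)⁻¹) * MR2e (MHL2e ω) z)) := by
        rw [← Finset.mul_sum]
        gcongr
        refine sum_mul_volume_le_of_sparse t a b c d hsparse m hm μ g _ (measurable_MR2e _)
          (fun j _ z hz => ?_) fun j hj => hg j (hts hj)
        have := hab j
        refine le_iSup₂_of_le (Rs j) ⟨⟨_, _, _, _, by linarith, hcd j, rfl⟩, ?_⟩ le_rfl
        exact ⟨⟨by linarith [hz.1.1], by linarith [hz.1.2]⟩, hz.2⟩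
    _ = _ := by rw [weakConst]; ring

lemma setLIntegral_preimage_swap (h : ℝ × ℝ → ℝ≥0∞) (A : Set (ℝ × ℝ)) :
    ∫⁻ z in Prod.swap ⁻¹' A, h z.swap = ∫⁻ z in A, h z :=
  (Measure.measurePreserving_swap (μ := volume) (ν := volume)).setLIntegral_comp_preimage_emb
    MeasurableEquiv.prodComm.measurableEmbedding h A

lemma volume_preimage_swap (A : Set (ℝ × ℝ)) : volume (Prod.swap ⁻¹' A) = volume A := by
  simpa using setLIntegral_preimage_swap 1 A

lemma MHL2e_comp_swap_le (g : ℝ × ℝ → ℝ≥0∞) (x : ℝ × ℝ) :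
    MHL2e (fun z => g z.swap) x ≤ MHL2e g x.swap := by
  refine iSup₂_le ?_
  rintro _ ⟨⟨a, b, r, hr, rfl⟩, hx⟩
  rw [← preimage_swap_prod, setLIntegral_preimage_swap, volume_preimage_swap]
  exact le_iSup₂_of_le (Ioo b (b + r) ×ˢ Ioo a (a + r)) ⟨⟨b, a, r, hr, rfl⟩, hx.2, hx.1⟩ le_rfl

lemma MR2e_comp_swap_le (g : ℝ × ℝ → ℝ≥0∞) (x : ℝ × ℝ) :
    MR2e (fun z => g z.swap) x ≤ MR2e g x.swap := by
  refine iSup₂_le ?_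
  rintro _ ⟨⟨a, b, c, d, hab, hcd, rfl⟩, hx⟩
  rw [← preimage_swap_prod, setLIntegral_preimage_swap, volume_preimage_swap]
  exact le_iSup₂_of_le (Ioo c d ×ˢ Ioo a b) ⟨⟨c, d, a, b, hcd, hab, rfl⟩, hx.2, hx.1⟩ le_rfl

lemma MR2e_mono {g h : ℝ × ℝ → ℝ≥0∞} (hgh : ∀ x, g x ≤ h x) (x : ℝ × ℝ) :
    MR2e g x ≤ MR2e h x :=
  iSup₂_mono fun _ _ => ENNReal.div_le_div_right (lintegral_mono hgh) _

lemma setLIntegral_tall_rects_le {ι : Type*} (s : Finset ι) (a b c d : ι → ℝ)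
    (hab : ∀ i, a i < b i) (hcd : ∀ i, c i < d i) (hw : ∀ i ∈ s, b i - a i ≤ d i - c i)
    (m : ℕ) (hm : m ≠ 0) (ω g : ℝ × ℝ → ℝ≥0∞)
    (hg : ∀ i ∈ s, volume (Ioo (a i) (b i) ×ˢ Ioo (c i) (d i)) ≤
      ∫⁻ z in Ioo (a i) (b i) ×ˢ Ioo (c i) (d i), g z) :
    ∫⁻ z in ⋃ i ∈ s, Ioo (a i) (b i) ×ˢ Ioo (c i) (d i), ω z ≤
      weakConst m * ∫⁻ z, g z ^ (1 + (m : ℝ)⁻¹) * MR2e (MHL2e ω) z := by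
  have h := setLIntegral_wide_rects_le s c d a b hcd hab hw m hm (fun z => ω z.swap)
    (fun z => g z.swap) fun i hi => by
      rw [← preimage_swap_prod, setLIntegral_preimage_swap, volume_preimage_swap]
      exact hg i hi
  simp_rw [← preimage_swap_prod (s := Ioo (a _) (b _)), ← preimage_iUnion,
    setLIntegral_preimage_swap] at h
  refine h.trans ?_
  gcongr weakConst m * ?_
  rw [← setLIntegral_univ (fun z => g z ^ (1 + (m : ℝ)⁻¹) * MR2e (MHL2e ω) z),
    ← setLIntegral_preimage_swap, preimage_univ, setLIntegral_univ]
  refine lintegral_mono fun z => ?_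
  gcongr
  exact (MR2e_mono (MHL2e_comp_swap_le ω) z).trans (MR2e_comp_swap_le _ z)

lemma setLIntegral_rects_le {ι : Type*} (s : Finset ι) (a b c d : ι → ℝ)
    (hab : ∀ i, a i < b i) (hcd : ∀ i, c i < d i)
    (m : ℕ) (hm : m ≠ 0) (ω g : ℝ × ℝ → ℝ≥0∞)
    (hg : ∀ i ∈ s, volume (Ioo (a i) (b i) ×ˢ Ioo (c i) (d i)) ≤
      ∫⁻ z in Ioo (a i) (b i) ×ˢ Ioo (c i) (d i), g z) :
    ∫⁻ z in ⋃ i ∈ s, Ioo (a i) (b i) ×ˢ Ioo (c i) (d i), ω z ≤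
      2 * weakConst m * ∫⁻ z, g z ^ (1 + (m : ℝ)⁻¹) * MR2e (MHL2e ω) z := by
  classical
  have hwide := setLIntegral_wide_rects_le {i ∈ s | d i - c i ≤ b i - a i} a b c d hab hcd
    (fun i hi => (Finset.mem_filter.1 hi).2) m hm ω g fun i hi => hg i (Finset.mem_filter.1 hi).1
  have htall := setLIntegral_tall_rects_le {i ∈ s | ¬ d i - c i ≤ b i - a i} a b c d hab hcd
    (fun i hi => (not_le.1 (Finset.mem_filter.1 hi).2).le) m hm ω g
    fun i hi => hg i (Finset.mem_filter.1 hi).1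
  rw [two_mul, add_mul]
  refine le_trans ?_ (add_le_add hwide htall)
  refine le_trans (lintegral_mono_set ?_) (lintegral_union_le _ _ _)
  rw [← Finset.set_biUnion_union, Finset.filter_union_filter_not_eq]

/-- A weak type estimate for the strong maximal operator, in abstract form. -/
lemma setLIntegral_levelSet_le (m : ℕ) (hm : m ≠ 0) (ω f h : ℝ × ℝ → ℝ≥0∞) (l : ℝ≥0∞)
    (hh : ∀ R, IsRect2 R → l < (∫⁻ y in R, f y) / volume R → volume R ≤ ∫⁻ y in R, h y) :
    ∫⁻ x in {x | l < MR2e f x}, ω x ≤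
      2 * weakConst m * ∫⁻ z, h z ^ (1 + (m : ℝ)⁻¹) * MR2e (MHL2e ω) z := by
  let ι := {R : Set (ℝ × ℝ) // IsRect2 R ∧ l < (∫⁻ y in R, f y) / volume R}
  have hset : {x | l < MR2e f x} = ⋃ R : ι, (R : Set (ℝ × ℝ)) := by
    ext x
    simp only [MR2e, mem_ofPred_eq, lt_iSup_iff, mem_iUnion]
    exact ⟨fun ⟨R, ⟨h1, h2⟩, h3⟩ => ⟨⟨R, h1, h3⟩, h2⟩, fun ⟨R, h⟩ => ⟨R, ⟨R.2.1, h⟩, R.2.2⟩⟩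
  have hopen : ∀ R : ι, IsOpen (R : Set (ℝ × ℝ)) := fun R => R.2.1.isOpen
  obtain ⟨T, hT, hTU⟩ := TopologicalSpace.isOpen_iUnion_countable (fun R : ι => (R : Set (ℝ × ℝ)))
    hopen
  have hfin : ∀ s : Finset ι, ∫⁻ x in ⋃ R ∈ s, (R : Set (ℝ × ℝ)), ω x ≤
      2 * weakConst m * ∫⁻ z, h z ^ (1 + (m : ℝ)⁻¹) * MR2e (MHL2e ω) z := by
    intro s
    choose a b c d hab hcd hR using fun R : ι => R.2.1
    simp_rw [hR]
    refine setLIntegral_rects_le s a b c d hab hcd m hm ω h fun R _ => ?_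
    rw [← hR R]
    exact hh R R.2.1 R.2.2
  have hmeas : ∀ s : Finset T, MeasurableSet (⋃ R ∈ s, (R : Set (ℝ × ℝ))) := fun s =>
    s.measurableSet_biUnion fun R _ => (hopen R).measurableSet
  have hT' : Countable T := hT.to_subtype
  rw [hset, ← hTU, biUnion_eq_iUnion, iUnion_eq_iUnion_finset, ← withDensity_apply _
    (MeasurableSet.iUnion hmeas), Directed.measure_iUnion]
  · refine iSup_le fun s => ?_
    rw [withDensity_apply _ (hmeas s)]
    refine le_trans (le_of_eq ?_) (hfin (s.map (Function.Embedding.subtype _)))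
    simp
  · exact (Monotone.directed_le fun s t hst => biUnion_subset_biUnion_left hst)

lemma IsRect2.volume_ne_zero {R : Set (ℝ × ℝ)} (h : IsRect2 R) : volume R ≠ 0 := by
  obtain ⟨a₁, b₁, a₂, b₂, h₁, h₂, rfl⟩ := h
  rw [volume_Ioo_prod]
  simp [h₁, h₂]

lemma IsRect2.volume_ne_top {R : Set (ℝ × ℝ)} (h : IsRect2 R) : volume R ≠ ⊤ := by
  obtain ⟨a₁, b₁, a₂, b₂, h₁, h₂, rfl⟩ := h
  rw [volume_Ioo_prod]
  exact ENNReal.mul_ne_top ENNReal.ofReal_ne_top ENNReal.ofReal_ne_top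

lemma setLIntegral_levelSet_le_truncation (m : ℕ) (hm : m ≠ 0) (ω f : ℝ × ℝ → ℝ≥0∞)
    (l : ℝ≥0∞) (hl0 : l ≠ 0) (hlt : l ≠ ⊤) :
    ∫⁻ x in {x | l < MR2e f x}, ω x ≤ 2 * weakConst m *
      ∫⁻ z, (if l / 2 < f z then 2 / l * f z else 0) ^ (1 + (m : ℝ)⁻¹) * MR2e (MHL2e ω) z := by
  refine setLIntegral_levelSet_le m hm ω f _ l fun R hR hlR => ?_
  have hc : 2 / l ≠ ⊤ := ENNReal.div_ne_top (by simp) hl0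
  have hlv : l / 2 * volume R ≠ ⊤ :=
    ENNReal.mul_ne_top (ENNReal.div_ne_top hlt (by simp)) hR.volume_ne_top
  rw [ENNReal.lt_div_iff_mul_lt (Or.inl hR.volume_ne_zero) (Or.inl hR.volume_ne_top)] at hlR
  have hsplit : ∫⁻ y in R, f y ≤ (∫⁻ y in R, if l / 2 < f y then f y else 0) + l / 2 * volume R := by
    rw [← setLIntegral_const, ← lintegral_add_right _ measurable_const]
    refine lintegral_mono fun y => ?_
    dsimp only
    split_ifs with h
    · exact le_self_add
    · simpa using h
  have hhalf : l / 2 * volume R ≤ ∫⁻ y in R, if l / 2 < f y then f y else 0 := by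
    refine (ENNReal.add_le_add_iff_right hlv).1 ?_
    rw [← add_mul, ENNReal.add_halves]
    exact hlR.le.trans hsplit
  calc volume R = 2 / l * (l / 2 * volume R) := by
        rw [← mul_assoc, ← ENNReal.inv_div (by simp) (by simp),
          ENNReal.inv_mul_cancel (by simp [hl0]) (ENNReal.div_ne_top hlt (by simp)), one_mul]
    _ ≤ 2 / l * ∫⁻ y in R, if l / 2 < f y then f y else 0 := by gcongr
    _ = _ := by
        rw [← lintegral_const_mul' _ _ hc]
        simp only [mul_ite, mul_zero]

lemma two_zpow_ne_zero (n : ℤ) : (2 : ℝ≥0∞) ^ n ≠ 0 :=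
  (ENNReal.zpow_pos (by simp) (by simp) n).ne'

lemma two_zpow_ne_top (n : ℤ) : (2 : ℝ≥0∞) ^ n ≠ ⊤ :=
  (ENNReal.zpow_lt_top (by simp) (by simp) n).ne

lemma rpow_le_tsum_dyadic (F : ℝ≥0∞) {p : ℝ} (hp : 0 < p) :
    F ^ p ≤ ∑' n : ℤ, if (2 : ℝ≥0∞) ^ n < F then ((2 : ℝ≥0∞) ^ (n + 1)) ^ p else 0 := by
  rcases eq_or_ne F 0 with rfl | h0
  · simp [hp]
  rcases eq_or_ne F ⊤ with rfl | ht
  · have hlim : Filter.Tendsto (fun n : ℕ => ((2 : ℝ≥0∞) ^ n) ^ p) Filter.atTop (nhds (⊤ ^ p)) :=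
      (ENNReal.continuous_rpow_const.tendsto _).comp
        (ENNReal.tendsto_pow_atTop_nhds_top_iff.2 (by norm_num))
    refine le_of_tendsto' hlim fun n => ?_
    refine le_trans ?_ (ENNReal.le_tsum ((n : ℤ) - 1))
    simp [(two_zpow_ne_top _).lt_top]
  · obtain ⟨n, h1, h2⟩ := ENNReal.exists_mem_Ioc_zpow h0 ht (y := 2) (by norm_num) (by simp)
    refine le_trans ?_ (ENNReal.le_tsum n)
    rw [if_pos h1]
    gcongr

lemma dyadic_term_eq {u : ℝ≥0∞} (hu0 : u ≠ 0) (hut : u ≠ ⊤) (f : ℝ≥0∞) {p q : ℝ} (hq : 0 < q)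
    (hqp : q < p) : (u * 2) ^ p * (2 / u * f) ^ q = 2 ^ (p + q) * u ^ (p - q) * f ^ q := by
  have hp : 0 ≤ p := (hq.trans hqp).le
  rw [ENNReal.mul_rpow_of_nonneg _ _ hp, ENNReal.mul_rpow_of_nonneg _ _ hq.le,
    ENNReal.div_rpow_of_nonneg _ _ hq.le, ENNReal.rpow_sub _ _ hu0 hut,
    ENNReal.rpow_add _ _ (by simp) (by simp), div_eq_mul_inv, div_eq_mul_inv]
  ring

/-- Constant in the dyadic summation. -/
def dyadicConst (p q : ℝ) : ℝ≥0∞ :=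
  2 ^ (p + q) * 2 ^ (p - q) * (1 - (2⁻¹ : ℝ≥0∞) ^ (p - q))⁻¹

lemma dyadicConst_ne_top {p q : ℝ} (hq : 0 < q) (hqp : q < p) : dyadicConst p q ≠ ⊤ := by
  have hr : (2⁻¹ : ℝ≥0∞) ^ (p - q) < 1 := ENNReal.rpow_lt_one (by norm_num) (by linarith)
  refine ENNReal.mul_ne_top (ENNReal.mul_ne_top ?_ ?_) ?_
  · exact ENNReal.rpow_ne_top_of_nonneg (by linarith) (by simp)
  · exact ENNReal.rpow_ne_top_of_nonneg (by linarith) (by simp)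
  · exact ENNReal.inv_ne_top.2 (tsub_pos_of_lt hr).ne'

lemma dyadicConst_ne_zero (p q : ℝ) : dyadicConst p q ≠ 0 := by
  simp [dyadicConst, ENNReal.rpow_eq_zero_iff]

lemma tsum_dyadic_le (f : ℝ≥0∞) {p q : ℝ} (hq : 0 < q) (hqp : q < p) :
    ∑' n : ℤ, ((2 : ℝ≥0∞) ^ (n + 1)) ^ p *
      (if (2 : ℝ≥0∞) ^ n / 2 < f then 2 / (2 : ℝ≥0∞) ^ n * f else 0) ^ q ≤
        dyadicConst p q * f ^ p := by
  have hp : 0 < p := hq.trans hqp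
  rcases eq_or_ne f 0 with rfl | h0
  · simp [hq]
  rcases eq_or_ne f ⊤ with rfl | ht
  · rw [ENNReal.top_rpow_of_pos hp, ENNReal.mul_top (dyadicConst_ne_zero p q)]
    exact le_top
  obtain ⟨N, hN1, hN2⟩ := ENNReal.exists_mem_Ioc_zpow h0 ht (y := 2) (by norm_num) (by simp)
  have hinj : Function.Injective fun j : ℕ => N + 1 - (j : ℤ) := fun i j hij => by
    simp only at hij
    omega
  rw [← hinj.tsum_eq]
  · have hbound : ∀ j : ℕ, (2 : ℝ≥0∞) ^ (N + 1 - (j : ℤ)) ≤ 2 * f * 2⁻¹ ^ j := by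
      intro j
      rw [ENNReal.zpow_sub (by simp) (by simp), ENNReal.zpow_add (by simp) (by simp), zpow_one,
        zpow_natCast, ENNReal.inv_pow, mul_comm _ (2 : ℝ≥0∞)]
      gcongr
    calc _ ≤ ∑' j : ℕ, 2 ^ (p + q) * 2 ^ (p - q) * f ^ p * ((2⁻¹ : ℝ≥0∞) ^ (p - q)) ^ j := by
          refine ENNReal.tsum_le_tsum fun j => ?_
          set n : ℤ := N + 1 - (j : ℤ) with hn
          calc _ ≤ ((2 : ℝ≥0∞) ^ (n + 1)) ^ p * (2 / (2 : ℝ≥0∞) ^ n * f) ^ q := by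
                gcongr
                split_ifs
                · exact le_rfl
                · exact zero_le
            _ = 2 ^ (p + q) * ((2 : ℝ≥0∞) ^ n) ^ (p - q) * f ^ q := by
                rw [ENNReal.zpow_add (by simp) (by simp), zpow_one,
                  dyadic_term_eq (two_zpow_ne_zero n) (two_zpow_ne_top n) f hq hqp]
            _ ≤ 2 ^ (p + q) * (2 * f * 2⁻¹ ^ j) ^ (p - q) * f ^ q := by
                have := hbound j
                have : 0 ≤ p - q := by linarith
                gcongr
            _ = _ := by
                have h1 : 0 ≤ p - q := by linarith
                have h2 : f ^ p = f ^ (p - q) * f ^ q := by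
                  rw [← ENNReal.rpow_add _ _ h0 ht, sub_add_cancel]
                rw [ENNReal.mul_rpow_of_nonneg _ _ h1, ENNReal.mul_rpow_of_nonneg _ _ h1, h2,
                  ← ENNReal.rpow_natCast, ← ENNReal.rpow_natCast, ← ENNReal.rpow_mul,
                  ← ENNReal.rpow_mul, mul_comm (j : ℝ)]
                ring
      _ = _ := by
          rw [ENNReal.tsum_mul_left, ENNReal.tsum_geometric, dyadicConst]
          ring
  · intro n hn
    have hlt : (2 : ℝ≥0∞) ^ n / 2 < f := by
      by_contra h
      simp [h, hq] at hn
    have hnN : n < N + 2 := by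
      by_contra h
      rw [not_lt] at h
      refine absurd (hlt.trans_le hN2) (not_lt.2 ?_)
      rw [ENNReal.le_div_iff_mul_le (by simp) (by simp)]
      calc (2 : ℝ≥0∞) ^ (N + 1) * 2 = 2 ^ (N + 2) := by
            rw [show N + 2 = N + 1 + 1 by ring, ENNReal.zpow_add (x := 2) (by simp) (by simp) (N + 1),
              zpow_one]
        _ ≤ 2 ^ n := ENNReal.zpow_le_of_le (by norm_num) h
    exact ⟨(N + 1 - n).toNat, by simp only; omega⟩

lemma lintegral_MR2e_rpow_le (m : ℕ) (hm : m ≠ 0) {p : ℝ} (hp : 1 + (m : ℝ)⁻¹ < p)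
    (ω f : ℝ × ℝ → ℝ≥0∞) (hω : AEMeasurable ω) :
    ∫⁻ x, MR2e f x ^ p * ω x ≤ 2 * weakConst m * dyadicConst p (1 + (m : ℝ)⁻¹) *
      ∫⁻ x, f x ^ p * MR2e (MHL2e ω) x := by
  set q := 1 + (m : ℝ)⁻¹ with hq
  have hq0 : 0 < q := by positivity
  have hp0 : 0 < p := hq0.trans hp
  let c : ℤ → ℝ≥0∞ := fun n => ((2 : ℝ≥0∞) ^ (n + 1)) ^ p
  have hc : ∀ n, c n ≠ ⊤ := fun n => ENNReal.rpow_ne_top_of_nonneg hp0.le (two_zpow_ne_top _)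
  let h : ℤ → ℝ × ℝ → ℝ≥0∞ := fun n z =>
    if (2 : ℝ≥0∞) ^ n / 2 < f z then 2 / (2 : ℝ≥0∞) ^ n * f z else 0
  have hmeas : ∀ n : ℤ, MeasurableSet {x | (2 : ℝ≥0∞) ^ n < MR2e f x} := fun n =>
    measurableSet_lt measurable_const (measurable_MR2e f)
  set D := 2 * weakConst m with hD
  have hDt : D ≠ ⊤ := ENNReal.mul_ne_top (by simp) (weakConst_ne_top m)
  calc ∫⁻ x, MR2e f x ^ p * ω x
      ≤ ∫⁻ x, ∑' n : ℤ, {x | (2 : ℝ≥0∞) ^ n < MR2e f x}.indicator (fun x => c n * ω x) x := by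
        refine lintegral_mono fun x => ?_
        refine (mul_le_mul_left (rpow_le_tsum_dyadic (MR2e f x) hp0) (ω x)).trans (le_of_eq ?_)
        rw [← ENNReal.tsum_mul_right]
        refine tsum_congr fun n => ?_
        simp only [indicator_apply, mem_ofPred_eq, ite_mul, zero_mul, c]
    _ = ∑' n : ℤ, c n * ∫⁻ x in {x | (2 : ℝ≥0∞) ^ n < MR2e f x}, ω x := by
        rw [lintegral_tsum fun n => (hω.const_mul (c n)).indicator (hmeas n)]
        refine tsum_congr fun n => ?_
        rw [lintegral_indicator (hmeas n), lintegral_const_mul' _ _ (hc n)]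
    _ ≤ ∑' n : ℤ, c n * (D * ∫⁻ z, h n z ^ q * MR2e (MHL2e ω) z) := by
        gcongr with n
        exact setLIntegral_levelSet_le_truncation m hm ω f _ (two_zpow_ne_zero n)
          (two_zpow_ne_top n)
    _ = D * ∑' n : ℤ, ∫⁻ z, c n * (h n z ^ q * MR2e (MHL2e ω) z) := by
        rw [← ENNReal.tsum_mul_left]
        refine tsum_congr fun n => ?_
        rw [lintegral_const_mul' _ _ (hc n), mul_left_comm]
    _ ≤ D * ∫⁻ z, dyadicConst p q * (f z ^ p * MR2e (MHL2e ω) z) := by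
        gcongr
        refine (tsum_lintegral_le _).trans (lintegral_mono fun z => ?_)
        simp_rw [← mul_assoc]
        rw [ENNReal.tsum_mul_right]
        gcongr
        exact tsum_dyadic_le (f z) hq0 hp
    _ = _ := by
        rw [lintegral_const_mul' _ _ (dyadicConst_ne_top hq0 hp), ← mul_assoc]

/-- `L^p` Fefferman–Stein type inequality for the strong maximal operator in the
plane, with iterated majorant `W = M_R M_Q w`. -/
theorem strong_maximal_Lp_FS (p : ℝ) (hp : 1 < p) :
    ∃ C : ℝ, 0 < C ∧
      ∀ (w f : ℝ × ℝ → ℝ), (∀ x, 0 ≤ w x) → LocallyIntegrable w volume →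
        (∫⁻ x, ENNReal.ofReal (|f x| ^ p) * MR2e (MHL2 w) x) < ⊤ →
          (∫⁻ x, (MR2 f x) ^ p * ENNReal.ofReal (w x)) ^ (1 / p) ≤
            ENNReal.ofReal C *
              (∫⁻ x, ENNReal.ofReal (|f x| ^ p) * MR2e (MHL2 w) x) ^ (1 / p) := by
  obtain ⟨k, hk⟩ := exists_nat_one_div_lt (sub_pos.2 hp)
  have hm : 1 + ((k + 1 : ℕ) : ℝ)⁻¹ < p := by
    rw [one_div] at hk
    push_cast
    linarith
  have hp0 : 0 < p := zero_lt_one.trans hp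
  set D := 2 * weakConst (k + 1) * dyadicConst p (1 + ((k + 1 : ℕ) : ℝ)⁻¹) with hD
  have hDt : D ≠ ⊤ := ENNReal.mul_ne_top (ENNReal.mul_ne_top (by simp) (weakConst_ne_top _))
    (dyadicConst_ne_top (by positivity) hm)
  have hDp : D ^ (1 / p) ≠ ⊤ := ENNReal.rpow_ne_top_of_nonneg (by positivity) hDt
  refine ⟨(D ^ (1 / p)).toReal + 1, by positivity, fun w f hw hwi _ => ?_⟩
  have hMHL : MHL2 w = MHL2e fun x => ENNReal.ofReal (w x) := by
    funext x
    simp only [MHL2, MHL2e, abs_of_nonneg (hw _)]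
  have hf : ∀ x, ENNReal.ofReal (|f x| ^ p) = ENNReal.ofReal |f x| ^ p := fun x =>
    (ENNReal.ofReal_rpow_of_nonneg (abs_nonneg _) hp0.le).symm
  simp_rw [hf, hMHL]
  have hmain := lintegral_MR2e_rpow_le (k + 1) k.succ_ne_zero hm (fun x => ENNReal.ofReal (w x))
    (fun x => ENNReal.ofReal |f x|) hwi.aestronglyMeasurable.aemeasurable.ennreal_ofReal
  refine (ENNReal.rpow_le_rpow hmain (by positivity)).trans ?_
  rw [ENNReal.mul_rpow_of_nonneg _ _ (by positivity)]
  gcongr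
  rw [ENNReal.le_ofReal_iff_toReal_le hDp (by positivity)]
  linarith
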